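/- Let k ≥ 1 and let c_1,…,c_k be integers with c_i ≥ 2 for all i. Then the q-continuant E_k(c_1,…,c_k)_q ∈ ℤ[q] is a monic polynomial of degree d = (c_1−1) + (c_2−1) + ⋯ + (c_k−1), its constant coefficient equals 1, and the coefficient of q^j is a positive integer for every 0 ≤ j ≤ d. -/

import Mathlib

/-- The `q`-integer `[c]_q = 1 + q + ⋯ + q^{c-1}` in `ℤ[q]`. -/
noncomputable def qN (c : ℕ) : Polynomial ℤ := ∑ i ∈ Finset.range c, Polynomial.X ^ i

/-- The tridiagonal matrix whose determinant is the `q`-continuant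
`E_k(c_1,…,c_k)_q` (here `c` is 0-indexed: `c 0 = c_1`). -/
noncomputable def Emat (k : ℕ) (c : ℕ → ℕ) : Matrix (Fin k) (Fin k) (Polynomial ℤ) :=
  Matrix.of fun i j =>
    if (i : ℕ) = (j : ℕ) then qN (c i)
    else if (j : ℕ) = (i : ℕ) + 1 then Polynomial.X ^ (c i - 1)
    else if (i : ℕ) = (j : ℕ) + 1 then 1
    else 0

/-- The `q`-continuant `E_k(c_1,…,c_k)_q ∈ ℤ[q]` (0-indexed `c`); `Econt 0 c = 1`. -/
noncomputable def Econt (k : ℕ) (c : ℕ → ℕ) : Polynomial ℤ := (Emat k c).det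

/-- The matrix `M(c_1,…,c_k)_q = ∏_{i=1}^{k} [[ [c_i]_q, −q^{c_i−1} ], [1, 0]]` over `ℤ[q]`. -/
noncomputable def Mmat (k : ℕ) (c : ℕ → ℕ) : Matrix (Fin 2) (Fin 2) (Polynomial ℤ) :=
  ((List.range k).map fun i => !![qN (c i), -(Polynomial.X ^ (c i - 1)); 1, 0]).prod

theorem Econt_zero (c : ℕ → ℕ) : Econt 0 c = 1 := by
  simp [Econt]

theorem Econt_one (c : ℕ → ℕ) : Econt 1 c = qN (c 0) := by
  simp [Econt, Emat]

theorem Emat_minor (n : ℕ) (c : ℕ → ℕ) :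
    (Emat (n + 1) c).submatrix Fin.castSucc Fin.castSucc = Emat n c := by
  ext i j
  simp [Emat]

theorem Econt_rec (n : ℕ) (c : ℕ → ℕ) :
    Econt (n + 2) c = qN (c (n + 1)) * Econt (n + 1) c
      - Polynomial.X ^ (c n - 1) * Econt n c := by
  have h1 : ∀ m (i : Fin m), (i : ℕ) ≠ m := fun m i => i.2.ne
  have hB : ((Emat (n + 2) c).submatrix Fin.castSucc
      (Fin.succAbove (Fin.castSucc (Fin.last n)))).det
      = Polynomial.X ^ (c n - 1) * Econt n c := by
    rw [Matrix.det_succ_column _ (Fin.last n), Fin.sum_univ_castSucc]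
    rw [Finset.sum_eq_zero]
    · have hs : (((Emat (n + 2) c).submatrix Fin.castSucc
          (Fin.succAbove (Fin.castSucc (Fin.last n)))).submatrix
          (Fin.succAbove (Fin.last n)) (Fin.succAbove (Fin.last n))) = Emat n c := by
        ext i j
        have : Fin.succAbove (Fin.castSucc (Fin.last n)) (Fin.castSucc j)
            = Fin.castSucc (Fin.castSucc j) := by
          apply Fin.succAbove_of_castSucc_lt
          simp [Fin.lt_def]
        simp [Emat, this]
      rw [hs]
      have : Fin.succAbove (Fin.castSucc (Fin.last n)) (Fin.last n) = Fin.last (n + 1) := by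
        rw [Fin.succAbove_of_le_castSucc _ _ le_rfl]
        simp
      simp only [Matrix.submatrix_apply, this]
      simp [Emat, Econt, ← two_mul]
    · intro i _
      have : Fin.succAbove (Fin.castSucc (Fin.last n)) (Fin.last n) = Fin.last (n + 1) := by
        rw [Fin.succAbove_of_le_castSucc _ _ le_rfl]
        simp
      have hi := i.2
      have hz : Emat (n + 2) c (Fin.castSucc (Fin.castSucc i)) (Fin.last (n + 1)) = 0 := by
        simp only [Emat, Matrix.of_apply, Fin.val_castSucc, Fin.val_last]
        rw [if_neg (by omega), if_neg (by omega), if_neg (by omega)]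
      simp only [Matrix.submatrix_apply, this, hz]
      simp
  unfold Econt at *
  rw [Matrix.det_succ_row _ (Fin.last (n + 1)), Fin.sum_univ_castSucc, Fin.sum_univ_castSucc,
    Finset.sum_eq_zero]
  · have e1 : Emat (n + 2) c (Fin.last (n + 1)) (Fin.castSucc (Fin.last n)) = 1 := by
      simp [Emat]
      omega
    have e2 : Emat (n + 2) c (Fin.last (n + 1)) (Fin.last (n + 1)) = qN (c (n + 1)) := by
      simp [Emat]
    rw [e1, e2]
    simp only [Fin.succAbove_last]
    rw [hB, Emat_minor]
    have s1 : (-1 : Polynomial ℤ) ^ (n + 1 + n) = -1 := Odd.neg_one_pow ⟨n, by ring⟩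
    have s2 : (-1 : Polynomial ℤ) ^ (n + 1 + (n + 1)) = 1 := Even.neg_one_pow ⟨n + 1, by ring⟩
    simp only [Fin.val_castSucc, Fin.val_last, s1, s2]
    ring
  · intro i _
    have hi := i.2
    have hz : Emat (n + 2) c (Fin.last (n + 1)) (Fin.castSucc (Fin.castSucc i)) = 0 := by
      simp only [Emat, Matrix.of_apply, Fin.val_castSucc, Fin.val_last]
      rw [if_neg (by omega), if_neg (by omega), if_neg (by omega)]
    rw [hz]
    simp

theorem qN_succ (m : ℕ) : qN (m + 1) = qN m + Polynomial.X ^ m := by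
  simp [qN, Finset.sum_range_succ]

theorem qN_succ' (m : ℕ) : qN (m + 1) = Polynomial.X * qN m + 1 := by
  simp [qN, Finset.sum_range_succ', Finset.mul_sum, pow_succ']

/-- Auxiliary sequence `D_0 = 1`, `D_{n+1} = q [c_{n+1}-2] E_n + D_n`. -/
noncomputable def Daux (c : ℕ → ℕ) : ℕ → Polynomial ℤ
  | 0 => 1
  | n + 1 => Polynomial.X * qN (c n - 2) * Econt n c + Daux c n

theorem Econt_succ (c : ℕ → ℕ) (n : ℕ) (hc : ∀ i < n + 1, 2 ≤ c i) :
    Econt (n + 1) c = Polynomial.X * qN (c n - 1) * Econt n c + Daux c n := by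
  induction n with
  | zero =>
    obtain ⟨m, hm⟩ := Nat.exists_eq_add_of_le' (hc 0 (by omega))
    simp [Econt_one, Econt_zero, Daux, hm, qN_succ' (m + 1)]
  | succ n ih =>
    have ih := ih (fun i hi => hc i (by omega))
    obtain ⟨m, hm⟩ := Nat.exists_eq_add_of_le' (hc n (by omega))
    obtain ⟨l, hl⟩ := Nat.exists_eq_add_of_le' (hc (n + 1) (by omega))
    have e1 : c n - 2 = m := by omega
    have e2 : c n - 1 = m + 1 := by omega
    have e3 : c (n + 1) - 1 = l + 1 := by omega
    rw [e2, qN_succ] at ih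
    rw [Econt_rec, Daux, e1, e2, e3, hl, qN_succ' (l + 1)]
    linear_combination ih

theorem coeff_XqN (m : ℕ) (p : Polynomial ℤ) (j : ℕ) :
    (Polynomial.X * qN m * p).coeff j
      = ∑ i ∈ Finset.range m, if i + 1 ≤ j then p.coeff (j - (i + 1)) else 0 := by
  simp only [qN, Finset.mul_sum, Finset.sum_mul, ← pow_succ', Polynomial.finsetSum_coeff,
    Polynomial.coeff_X_pow_mul']

theorem Econt_inv (c : ℕ → ℕ) (n : ℕ) (hc : ∀ i < n, 2 ≤ c i) :
    (∀ j, ∑ i ∈ Finset.range n, (c i - 1) < j → (Econt n c).coeff j = 0) ∧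
    (Econt n c).coeff (∑ i ∈ Finset.range n, (c i - 1)) = 1 ∧
    (Econt n c).coeff 0 = 1 ∧
    (∀ j ≤ ∑ i ∈ Finset.range n, (c i - 1), 0 < (Econt n c).coeff j) ∧
    (∀ j, ∑ i ∈ Finset.range n, (c i - 1) < j → (Daux c n).coeff j = 0) ∧
    (Daux c n).coeff 0 = 1 ∧ (∀ j, 0 ≤ (Daux c n).coeff j) := by
  induction n with
  | zero =>
    simp only [Econt_zero, Daux, Finset.range_zero, Finset.sum_empty, Polynomial.coeff_one]
    refine ⟨?_, by simp, by simp, ?_, ?_, by simp, ?_⟩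
    · intro j hj; rw [if_neg (by omega)]
    · intro j hj; rw [if_pos (by omega)]; exact one_pos
    · intro j hj; rw [if_neg (by omega)]
    · intro j; split_ifs <;> simp
  | succ n ih =>
    obtain ⟨h1, h2, h3, h4, h5, h6, h7⟩ := ih (fun i hi => hc i (by omega))
    obtain ⟨m, hm⟩ := Nat.exists_eq_add_of_le' (hc n (by omega))
    have e1 : c n - 2 = m := by omega
    have e2 : c n - 1 = m + 1 := by omega
    rw [Econt_succ c n hc, Finset.sum_range_succ, Daux, e1, e2]
    set d := ∑ i ∈ Finset.range n, (c i - 1) with hd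
    simp only [Polynomial.coeff_add, coeff_XqN]
    have h0 : ∀ j, 0 ≤ (Econt n c).coeff j := by
      intro j
      rcases le_or_gt j d with h | h
      · exact (h4 j h).le
      · exact (h1 j h).ge
    have hnn : ∀ j i, 0 ≤ (if i + 1 ≤ j then (Econt n c).coeff (j - (i + 1)) else 0) := by
      intro j i
      split_ifs
      · exact h0 _
      · exact le_rfl
    refine ⟨?_, ?_, ?_, ?_, ?_, ?_, ?_⟩
    · intro j hj
      rw [h5 j (by omega), Finset.sum_eq_zero, add_zero]
      intro i hi
      rw [Finset.mem_range] at hi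
      rw [if_pos (by omega), h1 _ (by omega)]
    · rw [h5 _ (by omega), Finset.sum_range_succ, Finset.sum_eq_zero, if_pos (by omega)]
      · simp [h2]
      · intro i hi
        rw [Finset.mem_range] at hi
        rw [if_pos (by omega), h1 _ (by omega)]
    · simp [h6]
    · intro j hj
      rcases Nat.eq_zero_or_pos j with rfl | hj0
      · simp [h6]
      · refine add_pos_of_pos_of_nonneg ?_ (h7 j)
        apply Finset.sum_pos' (fun i _ => hnn j i)
        refine ⟨min (j - 1) m, by rw [Finset.mem_range]; omega, ?_⟩
        rw [if_pos (by omega)]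
        exact h4 _ (by omega)
    · intro j hj
      rw [h5 j (by omega), Finset.sum_eq_zero, add_zero]
      intro i hi
      rw [Finset.mem_range] at hi
      rw [if_pos (by omega), h1 _ (by omega)]
    · simp [h6]
    · intro j
      exact add_nonneg (Finset.sum_nonneg fun i _ => hnn j i) (h7 j)

/-- for `k ≥ 1` and integers `c_i ≥ 2`, the `q`-continuant `E_k(c_1,…,c_k)_q`
is monic of degree `d = (c_1−1) + ⋯ + (c_k−1)`, has constant coefficient `1`, and all its
coefficients in degrees `0 ≤ j ≤ d` are positive integers. -/
theorem Econt_monic_positive (k : ℕ) (hk : 1 ≤ k) (c : ℕ → ℕ) (hc : ∀ i < k, 2 ≤ c i) :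
    (Econt k c).Monic ∧
    (Econt k c).natDegree = ∑ i ∈ Finset.range k, (c i - 1) ∧
    (Econt k c).coeff 0 = 1 ∧
    ∀ j ≤ ∑ i ∈ Finset.range k, (c i - 1), 0 < (Econt k c).coeff j := by
  obtain ⟨h1, h2, h3, h4, -⟩ := Econt_inv c k hc
  have hle : (Econt k c).natDegree ≤ ∑ i ∈ Finset.range k, (c i - 1) :=
    Polynomial.natDegree_le_iff_coeff_eq_zero.2 h1
  refine ⟨Polynomial.monic_of_natDegree_le_of_coeff_eq_one _ hle h2, ?_, h3, h4⟩
  exact le_antisymm hle (Polynomial.le_natDegree_of_ne_zero (by rw [h2]; exact one_ne_zero))
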